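/- Let f : [a,b] → X have the property S*HK on [a,b], let Z₁ = { t₁ ∈ [a₁,b₁] : the section f_{t₁} does not have the property S*HK on [a₂,b₂] }, Z₂ = { t₂ ∈ [a₂,b₂] : the section f_{t₂} does not have the property S*HK on [a₁,b₁] }, Z = (Z₁ × [a₂,b₂]) ∪ ([a₁,b₁] × Z₂), and f₀ = f·𝟙_{[a,b]∖Z}. Then the function h(t₂) = (HK)∫_{[a₁,b₁]} (f₀)_{t₂}, t₂ ∈ [a₂,b₂], is strongly Henstock–Kurzweil integrable on [a₂,b₂] and (HK)∫_{[a₂,b₂]} ((HK)∫_{[a₁,b₁]} (f₀)_{t₂}) = (HK)∫_{[a,b]} f. -/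

import Mathlib

open Set MeasureTheory

variable {E : Type*} [MeasureSpace E] [PseudoMetricSpace E] [Preorder E]
variable {X : Type*} [NormedAddCommGroup X] [NormedSpace ℝ X]

/-- The closed interval of a tagged item `(t, p, q)` is `[p, q]` (the tag is `t`). -/
def itemBox (x : E × E × E) : Set E := Set.Icc x.2.1 x.2.2

/-- `[p,q]` is a closed non-degenerate subinterval of `K`. -/
def IsSubinterval (K : Set E) (p q : E) : Prop :=
  Set.Icc p q ⊆ K ∧ (interior (Set.Icc p q)).Nonempty

/-- `P` is an `𝓜`-partition of `K`: a finite collection of tagged pairwise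
non-overlapping closed non-degenerate subintervals of `K` covering `K`, with tags in `K`. -/
def IsMPartition (K : Set E) (P : Finset (E × E × E)) : Prop :=
  (∀ x ∈ P, x.1 ∈ K ∧ IsSubinterval K x.2.1 x.2.2) ∧
  (∀ x ∈ P, ∀ y ∈ P, x ≠ y → interior (itemBox x) ∩ interior (itemBox y) = ∅) ∧
  (⋃ x ∈ P, itemBox x) = K

/-- `𝓗𝓚`-partition: an `𝓜`-partition each of whose tags belongs to its interval. -/
def IsHKPartition (K : Set E) (P : Finset (E × E × E)) : Prop :=
  IsMPartition K P ∧ ∀ x ∈ P, x.1 ∈ itemBox x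

/-- A gauge on `K`: positive on `K`. -/
def IsGauge (K : Set E) (δ : E → ℝ) : Prop := ∀ t ∈ K, 0 < δ t

/-- A tagged partition is `δ`-fine if each interval lies in the open ball
around its tag of radius `δ(tag)`. -/
def IsFine (δ : E → ℝ) (P : Finset (E × E × E)) : Prop :=
  ∀ x ∈ P, itemBox x ⊆ Metric.ball x.1 (δ x.1)

/-- `f` is McShane integrable on `K` with integral `v`. -/
def HasMcShaneIntegral (K : Set E) (f : E → X) (v : X) : Prop :=
  ∀ ε > 0, ∃ δ : E → ℝ, IsGauge K δ ∧
    ∀ P : Finset (E × E × E), IsMPartition K P → IsFine δ P →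
      ‖(∑ x ∈ P, (volume (itemBox x)).toReal • f x.1) - v‖ < ε

/-- `f` is Henstock–Kurzweil integrable on `K` with integral `v`. -/
def HasHKIntegral (K : Set E) (f : E → X) (v : X) : Prop :=
  ∀ ε > 0, ∃ δ : E → ℝ, IsGauge K δ ∧
    ∀ P : Finset (E × E × E), IsHKPartition K P → IsFine δ P →
      ‖(∑ x ∈ P, (volume (itemBox x)).toReal • f x.1) - v‖ < ε

/-- An additive interval function on the non-degenerate closed subintervals of `K`
(an interval is recorded by its pair of corners). -/
def IsAdditiveIntervalFun (K : Set E) (F : E × E → X) : Prop :=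
  ∀ p q r s u w : E, IsSubinterval K p q → IsSubinterval K r s → IsSubinterval K u w →
    interior (Set.Icc p q) ∩ interior (Set.Icc r s) = ∅ →
    Set.Icc p q ∪ Set.Icc r s = Set.Icc u w →
    F (u, w) = F (p, q) + F (r, s)

/-- `f` is strongly McShane integrable on `[a,b]` with `(M)∫_{[a,b]} f = v`. -/
def HasStrongMcShaneIntegral (a b : E) (f : E → X) (v : X) : Prop :=
  ∃ F : E × E → X, IsAdditiveIntervalFun (Set.Icc a b) F ∧ F (a, b) = v ∧
    ∀ ε > 0, ∃ δ : E → ℝ, IsGauge (Set.Icc a b) δ ∧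
      ∀ P : Finset (E × E × E), IsMPartition (Set.Icc a b) P → IsFine δ P →
        ∑ x ∈ P, ‖(volume (itemBox x)).toReal • f x.1 - F (x.2.1, x.2.2)‖ < ε

/-- `f` is strongly Henstock–Kurzweil integrable on `[a,b]` with `(HK)∫_{[a,b]} f = v`. -/
def HasStrongHKIntegral (a b : E) (f : E → X) (v : X) : Prop :=
  ∃ F : E × E → X, IsAdditiveIntervalFun (Set.Icc a b) F ∧ F (a, b) = v ∧
    ∀ ε > 0, ∃ δ : E → ℝ, IsGauge (Set.Icc a b) δ ∧
      ∀ P : Finset (E × E × E), IsHKPartition (Set.Icc a b) P → IsFine δ P →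
        ∑ x ∈ P, ‖(volume (itemBox x)).toReal • f x.1 - F (x.2.1, x.2.2)‖ < ε

/-- Property `𝓢*𝓜` on `[a,b]`. -/
def PropSM (a b : E) (f : E → X) : Prop :=
  ∀ ε > 0, ∃ δ : E → ℝ, IsGauge (Set.Icc a b) δ ∧
    ∀ P Q : Finset (E × E × E),
      IsMPartition (Set.Icc a b) P → IsFine δ P →
      IsMPartition (Set.Icc a b) Q → IsFine δ Q →
      ∑ x ∈ P, ∑ y ∈ Q, ‖f x.1 - f y.1‖ * (volume (itemBox x ∩ itemBox y)).toReal < ε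

/-- Property `𝓢*𝓗𝓚` on `[a,b]`. -/
def PropSHK (a b : E) (f : E → X) : Prop :=
  ∀ ε > 0, ∃ δ : E → ℝ, IsGauge (Set.Icc a b) δ ∧
    ∀ P Q : Finset (E × E × E),
      IsHKPartition (Set.Icc a b) P → IsFine δ P →
      IsHKPartition (Set.Icc a b) Q → IsFine δ Q →
      ∑ x ∈ P, ∑ y ∈ Q, ‖f x.1 - f y.1‖ * (volume (itemBox x ∩ itemBox y)).toReal < ε


set_option linter.unusedSectionVars false

/-- The Riemann sum of `f` along the tagged collection `P`. -/
abbrev riemannSum (f : E → X) (P : Finset (E × E × E)) : X :=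
  ∑ x ∈ P, (volume (itemBox x)).toReal • f x.1

/-- The sum of `‖f t - g s‖ |I ∩ J|` over `(t, I) ∈ P` and `(s, J) ∈ Q`. -/
abbrev overlapSum (f g : E → X) (P Q : Finset (E × E × E)) : ℝ :=
  ∑ x ∈ P, ∑ y ∈ Q, ‖f x.1 - g y.1‖ * (volume (itemBox x ∩ itemBox y)).toReal

lemma overlapSum_nonneg (f g : E → X) (P Q : Finset (E × E × E)) : 0 ≤ overlapSum f g P Q :=
  Finset.sum_nonneg fun _ _ => Finset.sum_nonneg fun _ _ => by positivity

lemma overlapSum_mono (f g : E → X) {P P' Q Q' : Finset (E × E × E)} (hP : P ⊆ P')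
    (hQ : Q ⊆ Q') : overlapSum f g P Q ≤ overlapSum f g P' Q' :=
  (Finset.sum_le_sum fun _ _ => Finset.sum_le_sum_of_subset_of_nonneg hQ
    fun _ _ _ => by positivity).trans
  (Finset.sum_le_sum_of_subset_of_nonneg hP
    fun _ _ _ => Finset.sum_nonneg fun _ _ => by positivity)

lemma IsFine.mono {δ δ' : E → ℝ} {P : Finset (E × E × E)} (h : IsFine δ P)
    (hle : ∀ x ∈ P, δ x.1 ≤ δ' x.1) : IsFine δ' P := fun x hx =>
  (h x hx).trans (Metric.ball_subset_ball (hle x hx))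

lemma IsHKPartition.box_subset {K : Set E} {P : Finset (E × E × E)} (h : IsHKPartition K P)
    {x : E × E × E} (hx : x ∈ P) : itemBox x ⊆ K := (h.1.1 x hx).2.1

lemma IsHKPartition.tag_mem {K : Set E} {P : Finset (E × E × E)} (h : IsHKPartition K P)
    {x : E × E × E} (hx : x ∈ P) : x.1 ∈ K := (h.1.1 x hx).1

/-- Two HK-partitions of non-overlapping sets combine to one of their union. -/
lemma IsHKPartition.union [DecidableEq (E × E × E)] {K L : Set E} {P Q : Finset (E × E × E)}
    (hP : IsHKPartition K P) (hQ : IsHKPartition L Q) (h : interior K ∩ interior L = ∅) :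
    IsHKPartition (K ∪ L) (P ∪ Q) := by
  have aux : ∀ x ∈ P, ∀ y ∈ Q, interior (itemBox x) ∩ interior (itemBox y) = ∅ :=
    fun x hx y hy => subset_empty_iff.1 <| h ▸
      inter_subset_inter (interior_mono (hP.box_subset hx)) (interior_mono (hQ.box_subset hy))
  refine ⟨⟨fun x hx => ?_, fun x hx y hy hxy => ?_, ?_⟩, fun x hx => ?_⟩
  · rcases Finset.mem_union.1 hx with hx | hx
    · exact ⟨Or.inl (hP.tag_mem hx), (hP.box_subset hx).trans subset_union_left,
        (hP.1.1 x hx).2.2⟩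
    · exact ⟨Or.inr (hQ.tag_mem hx), (hQ.box_subset hx).trans subset_union_right,
        (hQ.1.1 x hx).2.2⟩
  · rcases Finset.mem_union.1 hx with hx | hx <;> rcases Finset.mem_union.1 hy with hy | hy
    · exact hP.1.2.1 x hx y hy hxy
    · exact aux x hx y hy
    · rw [inter_comm]; exact aux y hy x hx
    · exact hQ.1.2.1 x hx y hy hxy
  · rw [Finset.set_biUnion_union, hP.1.2.2, hQ.1.2.2]
  · rcases Finset.mem_union.1 hx with hx | hx
    · exact hP.2 x hx
    · exact hQ.2 x hx

/-- Partitioning each interval of an HK-partition gives an HK-partition. -/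
lemma IsHKPartition.biUnion [DecidableEq (E × E × E)] {K : Set E} {P : Finset (E × E × E)}
    (hP : IsHKPartition K P) {R : E × E × E → Finset (E × E × E)}
    (hR : ∀ x ∈ P, IsHKPartition (itemBox x) (R x)) : IsHKPartition K (P.biUnion R) := by
  refine ⟨⟨fun z hz => ?_, fun z hz w hw hzw => ?_, ?_⟩, fun z hz => ?_⟩
  · obtain ⟨x, hx, hz⟩ := Finset.mem_biUnion.1 hz
    exact ⟨hP.box_subset hx ((hR x hx).tag_mem hz),
      ((hR x hx).box_subset hz).trans (hP.box_subset hx), ((hR x hx).1.1 z hz).2.2⟩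
  · obtain ⟨x, hx, hz⟩ := Finset.mem_biUnion.1 hz
    obtain ⟨y, hy, hw⟩ := Finset.mem_biUnion.1 hw
    by_cases hxy : x = y
    · subst hxy
      exact (hR x hx).1.2.1 z hz w hw hzw
    · exact subset_empty_iff.1 <| hP.1.2.1 x hx y hy hxy ▸
        inter_subset_inter (interior_mono ((hR x hx).box_subset hz))
          (interior_mono ((hR y hy).box_subset hw))
  · rw [Finset.set_biUnion_biUnion, ← hP.1.2.2]
    exact iUnion₂_congr fun x hx => (hR x hx).1.2.2
  · obtain ⟨x, hx, hz⟩ := Finset.mem_biUnion.1 hz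
    exact (hR x hx).2 z hz

lemma isSubinterval_Icc_iff {a b p q : ℝ} :
    IsSubinterval (Icc a b) p q ↔ a ≤ p ∧ p < q ∧ q ≤ b := by
  rw [IsSubinterval, interior_Icc, nonempty_Ioo]
  constructor
  · rintro ⟨h, hpq⟩
    exact ⟨((Icc_subset_Icc_iff hpq.le).1 h).1, hpq, ((Icc_subset_Icc_iff hpq.le).1 h).2⟩
  · rintro ⟨h₁, h, h₂⟩
    exact ⟨Icc_subset_Icc h₁ h₂, h⟩

lemma isHKPartition_singleton {p q t : ℝ} (hpq : p < q) (ht : t ∈ Icc p q) :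
    IsHKPartition (Icc p q) {(t, p, q)} := by
  refine ⟨⟨?_, ?_, ?_⟩, ?_⟩
  · simp only [Finset.mem_singleton, forall_eq]
    exact ⟨ht, isSubinterval_Icc_iff.2 ⟨le_rfl, hpq, le_rfl⟩⟩
  · simp only [Finset.mem_singleton, forall_eq]
    exact fun h => absurd rfl h
  · simp [itemBox]
  · simpa [itemBox] using ht

lemma IsHKPartition.union_Icc {a c b : ℝ} (hac : a ≤ c) (hcb : c ≤ b)
    {P Q : Finset (ℝ × ℝ × ℝ)} (hP : IsHKPartition (Icc a c) P)
    (hQ : IsHKPartition (Icc c b) Q) : IsHKPartition (Icc a b) (P ∪ Q) := by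
  rw [← Icc_union_Icc_eq_Icc hac hcb]
  refine hP.union hQ ?_
  rw [interior_Icc, interior_Icc, Ioo_inter_Ioo, Ioo_eq_empty_iff]
  simp [hac, hcb]

/-- Cousin's lemma. -/
lemma exists_isHKPartition_isFine {a b : ℝ} (hab : a < b) {δ : ℝ → ℝ}
    (hδ : IsGauge (Icc a b) δ) :
    ∃ P, IsHKPartition (Icc a b) P ∧ IsFine δ P := by
  set S : Set ℝ := {c | c ∈ Icc a b ∧
    (c = a ∨ a < c ∧ ∃ P, IsHKPartition (Icc a c) P ∧ IsFine δ P)} with hS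
  have haS : a ∈ S := ⟨⟨le_rfl, hab.le⟩, Or.inl rfl⟩
  have hbdd : BddAbove S := ⟨b, fun c hc => hc.1.2⟩
  set m := sSup S with hm
  have ham : a ≤ m := le_csSup hbdd haS
  have hmb : m ≤ b := csSup_le ⟨a, haS⟩ fun c hc => hc.1.2
  have hδm := hδ m ⟨ham, hmb⟩
  obtain ⟨c, hcS, hc⟩ := exists_lt_of_lt_csSup ⟨a, haS⟩ (show m - δ m < sSup S by linarith)
  have hcm : c ≤ m := le_csSup hbdd hcS
  have key : ∀ d, m ≤ d → c < d → d < m + δ m → d ≤ b → d ∈ S := by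
    intro d hmd hcd hd hdb
    have h1 := isHKPartition_singleton (t := m) hcd ⟨hcm, hmd⟩
    have h2 : IsFine δ {(m, c, d)} := by
      simp only [IsFine, Finset.mem_singleton, forall_eq, itemBox, Real.ball_eq_Ioo]
      exact fun z hz => ⟨hc.trans_le hz.1, hz.2.trans_lt hd⟩
    have had : a < d := hcS.1.1.trans_lt hcd
    refine ⟨⟨had.le, hdb⟩, Or.inr ⟨had, ?_⟩⟩
    rcases hcS.2 with rfl | ⟨hac, P, hP, hPf⟩
    · exact ⟨_, h1, h2⟩
    · refine ⟨_, hP.union_Icc hac.le hcd.le h1, fun x hx => ?_⟩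
      rcases Finset.mem_union.1 hx with hx | hx
      · exact hPf x hx
      · exact h2 x hx
  have hmb' : m = b := by
    by_contra hne
    have hlt : m < b := lt_of_le_of_ne hmb hne
    have := key (min b (m + δ m / 2)) (le_min hmb (by linarith))
      (lt_min (hcm.trans_lt hlt) (by linarith))
      ((min_le_right _ _).trans_lt (by linarith)) (min_le_left _ _)
    have h3 := le_csSup hbdd this
    rcases min_le_iff.1 h3 with h | h <;> linarith
  have hbS : b ∈ S := by
    rcases eq_or_lt_of_le hcm with h | h
    · rw [← hmb', ← h]; exact hcS
    · exact key b hmb (by linarith) (by linarith) le_rfl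
  rcases hbS.2 with h | ⟨-, h⟩
  · exact absurd h hab.ne'
  · exact h

lemma IsHKPartition.fst_lt_snd {a b : ℝ} {P : Finset (ℝ × ℝ × ℝ)}
    (h : IsHKPartition (Icc a b) P) {x : ℝ × ℝ × ℝ} (hx : x ∈ P) : x.2.1 < x.2.2 :=
  (isSubinterval_Icc_iff.1 (h.1.1 x hx).2).2.1

/-- The fine items of an HK-partition belong to some fine HK-partition. -/
lemma IsHKPartition.exists_isFine_refinement {a b : ℝ} {P : Finset (ℝ × ℝ × ℝ)}
    (hP : IsHKPartition (Icc a b) P) {δ : ℝ → ℝ} (hδ : IsGauge (Icc a b) δ) :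
    ∃ Q, IsHKPartition (Icc a b) Q ∧ IsFine δ Q ∧
      ∀ x ∈ P, itemBox x ⊆ Metric.ball x.1 (δ x.1) → x ∈ Q := by
  classical
  have hex : ∀ x : ℝ × ℝ × ℝ, ∃ R, x ∈ P → IsHKPartition (itemBox x) R ∧ IsFine δ R ∧
      (itemBox x ⊆ Metric.ball x.1 (δ x.1) → x ∈ R) := by
    intro x
    by_cases hx : x ∈ P
    · by_cases hf : itemBox x ⊆ Metric.ball x.1 (δ x.1)
      · refine ⟨{x}, fun _ => ⟨isHKPartition_singleton (hP.fst_lt_snd hx) (hP.2 x hx), ?_, ?_⟩⟩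
        · simpa [IsFine] using hf
        · simp
      · obtain ⟨R, hR, hRf⟩ := exists_isHKPartition_isFine (hP.fst_lt_snd hx)
          (δ := δ) fun t ht => hδ t (hP.box_subset hx ht)
        exact ⟨R, fun _ => ⟨hR, hRf, fun h => absurd h hf⟩⟩
    · exact ⟨∅, fun h => absurd h hx⟩
  choose R hR using hex
  refine ⟨P.biUnion R, hP.biUnion fun x hx => (hR x hx).1, fun z hz => ?_, fun x hx hf => ?_⟩
  · obtain ⟨x, hx, hz⟩ := Finset.mem_biUnion.1 hz
    exact (hR x hx).2.1 z hz
  · exact Finset.mem_biUnion.2 ⟨x, hx, (hR x hx).2.2 hf⟩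

/-- An HK-partition of `[a, b]` splits the length of each subinterval. -/
lemma IsHKPartition.sum_volume_inter {a b : ℝ} {P : Finset (ℝ × ℝ × ℝ)}
    (hP : IsHKPartition (Icc a b) P) {I : Set ℝ} (hI : I ⊆ Icc a b) (hm : MeasurableSet I) :
    ∑ x ∈ P, (volume (I ∩ itemBox x)).toReal = (volume I).toReal := by
  have hfin : ∀ x ∈ P, volume (I ∩ itemBox x) ≠ ⊤ := fun x _ =>
    ((measure_mono inter_subset_right).trans_lt (by rw [itemBox]; exact measure_Icc_lt_top)).ne
  rw [← ENNReal.toReal_sum hfin, ← measure_biUnion_finset₀, ← inter_iUnion₂, hP.1.2.2,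
    inter_eq_left.2 hI]
  · intro x hx y hy hxy
    have h := hP.1.2.1 x hx y hy hxy
    rw [itemBox, itemBox, interior_Icc, interior_Icc, Ioo_inter_Ioo, Ioo_eq_empty_iff] at h
    refine measure_mono_null (t := itemBox x ∩ itemBox y)
      (inter_subset_inter inter_subset_right inter_subset_right) ?_
    rw [itemBox, itemBox, Icc_inter_Icc, Real.volume_Icc, ENNReal.ofReal_eq_zero]
    linarith
  · exact fun x _ => (hm.inter measurableSet_Icc).nullMeasurableSet

lemma IsHKPartition.sum_volume {a b : ℝ} {P : Finset (ℝ × ℝ × ℝ)} (hab : a ≤ b)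
    (hP : IsHKPartition (Icc a b) P) : ∑ x ∈ P, (volume (itemBox x)).toReal = b - a := by
  have := hP.sum_volume_inter subset_rfl measurableSet_Icc
  rw [Real.volume_Icc, ENNReal.toReal_ofReal (by linarith)] at this
  rw [← this]
  exact Finset.sum_congr rfl fun x hx => by rw [inter_eq_right.2 (hP.box_subset hx)]

lemma IsHKPartition.sum_sum_left {a b : ℝ} {P Q : Finset (ℝ × ℝ × ℝ)}
    (hP : IsHKPartition (Icc a b) P) (hQ : IsHKPartition (Icc a b) Q) (w : ℝ × ℝ × ℝ → X) :
    ∑ x ∈ P, ∑ y ∈ Q, (volume (itemBox x ∩ itemBox y)).toReal • w x =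
      ∑ x ∈ P, (volume (itemBox x)).toReal • w x :=
  Finset.sum_congr rfl fun x hx => by
    rw [← Finset.sum_smul, hQ.sum_volume_inter (hP.box_subset hx) measurableSet_Icc]

lemma IsHKPartition.sum_sum_right {a b : ℝ} {P Q : Finset (ℝ × ℝ × ℝ)}
    (hP : IsHKPartition (Icc a b) P) (hQ : IsHKPartition (Icc a b) Q) (w : ℝ × ℝ × ℝ → X) :
    ∑ x ∈ P, ∑ y ∈ Q, (volume (itemBox x ∩ itemBox y)).toReal • w y =
      ∑ y ∈ Q, (volume (itemBox y)).toReal • w y := by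
  rw [Finset.sum_comm, ← hQ.sum_sum_left hP w]
  exact Finset.sum_congr rfl fun x _ => Finset.sum_congr rfl fun y _ => by rw [inter_comm]

lemma norm_riemannSum_sub_le {a b : ℝ} {P Q : Finset (ℝ × ℝ × ℝ)}
    (hP : IsHKPartition (Icc a b) P) (hQ : IsHKPartition (Icc a b) Q) (f g : ℝ → X) :
    ‖riemannSum f P - riemannSum g Q‖ ≤ overlapSum f g P Q := by
  rw [riemannSum, riemannSum, ← hP.sum_sum_left hQ (fun x => f x.1),
    ← hP.sum_sum_right hQ (fun y => g y.1), ← Finset.sum_sub_distrib]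
  refine (norm_sum_le _ _).trans (Finset.sum_le_sum fun x _ => ?_)
  rw [← Finset.sum_sub_distrib]
  refine (norm_sum_le _ _).trans (Finset.sum_le_sum fun y _ => ?_)
  rw [← smul_sub, norm_smul, Real.norm_of_nonneg ENNReal.toReal_nonneg, mul_comm]

lemma IsGauge.min {K : Set E} {δ δ' : E → ℝ} (h : IsGauge K δ) (h' : IsGauge K δ') :
    IsGauge K fun t => min (δ t) (δ' t) := fun t ht => lt_min (h t ht) (h' t ht)

lemma IsFine.of_min_left {δ δ' : E → ℝ} {P : Finset (E × E × E)}
    (h : IsFine (fun t => min (δ t) (δ' t)) P) : IsFine δ P := h.mono fun _ _ => min_le_left _ _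

lemma IsFine.of_min_right {δ δ' : E → ℝ} {P : Finset (E × E × E)}
    (h : IsFine (fun t => min (δ t) (δ' t)) P) : IsFine δ' P := h.mono fun _ _ => min_le_right _ _

lemma PropSHK.restrict_left {a c b : ℝ} (hac : a ≤ c) (hcb : c ≤ b) {f : ℝ → X}
    (h : PropSHK a b f) : PropSHK a c f := by
  rcases hcb.eq_or_lt with rfl | hcb
  · exact h
  intro ε hε
  obtain ⟨δ, hδ, H⟩ := h ε hε
  obtain ⟨R, hR, hRf⟩ := exists_isHKPartition_isFine hcb (δ := δ)
    fun t ht => hδ t ⟨hac.trans ht.1, ht.2⟩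
  have hf : ∀ P, IsFine δ P → IsFine δ (P ∪ R) := fun P hP x hx =>
    (Finset.mem_union.1 hx).elim (hP x) (hRf x)
  exact ⟨δ, fun t ht => hδ t ⟨ht.1, ht.2.trans hcb.le⟩, fun P Q hP hPf hQ hQf =>
    (overlapSum_mono f f Finset.subset_union_left Finset.subset_union_left).trans_lt
      (H (P ∪ R) (Q ∪ R) (hP.union_Icc hac hcb.le hR) (hf P hPf)
        (hQ.union_Icc hac hcb.le hR) (hf Q hQf))⟩

lemma PropSHK.restrict_right {a c b : ℝ} (hac : a ≤ c) (hcb : c ≤ b) {f : ℝ → X}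
    (h : PropSHK a b f) : PropSHK c b f := by
  rcases hac.eq_or_lt with rfl | hac
  · exact h
  intro ε hε
  obtain ⟨δ, hδ, H⟩ := h ε hε
  obtain ⟨R, hR, hRf⟩ := exists_isHKPartition_isFine hac (δ := δ)
    fun t ht => hδ t ⟨ht.1, ht.2.trans hcb⟩
  have hf : ∀ P, IsFine δ P → IsFine δ (R ∪ P) := fun P hP x hx =>
    (Finset.mem_union.1 hx).elim (hRf x) (hP x)
  exact ⟨δ, fun t ht => hδ t ⟨hac.le.trans ht.1, ht.2⟩, fun P Q hP hPf hQ hQf =>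
    (overlapSum_mono f f Finset.subset_union_right Finset.subset_union_right).trans_lt
      (H (R ∪ P) (R ∪ Q) (hR.union_Icc hac.le hcb hP) (hf P hPf)
        (hR.union_Icc hac.le hcb hQ) (hf Q hQf))⟩

/-- A function with the property `𝓢*𝓗𝓚` is Henstock–Kurzweil integrable. -/
lemma PropSHK.exists_hasHKIntegral [CompleteSpace X] {a b : ℝ} (hab : a < b) {f : ℝ → X}
    (h : PropSHK a b f) : ∃ v, HasHKIntegral (Icc a b) f v := by
  choose δ hδ H using fun n : ℕ => h (1 / ((n : ℝ) + 1)) Nat.one_div_pos_of_nat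
  have hg : ∀ n, IsGauge (Icc a b)
      fun t => (Finset.range (n + 1)).inf' Finset.nonempty_range_add_one fun k => δ k t :=
    fun n t ht => (Finset.lt_inf'_iff _).2 fun k _ => hδ k t ht
  choose P hP hPf using fun n => exists_isHKPartition_isFine hab (hg n)
  have hfine : ∀ N n, N ≤ n → IsFine (δ N) (P n) := fun N n hn =>
    (hPf n).mono fun x _ => Finset.inf'_le (fun k => δ k x.1) (by simpa using by omega)
  have hlt : ∀ N n Q, N ≤ n → IsHKPartition (Icc a b) Q → IsFine (δ N) Q →
      ‖riemannSum f Q - riemannSum f (P n)‖ < 1 / ((N : ℝ) + 1) := fun N n Q hn hQ hQf =>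
    (norm_riemannSum_sub_le hQ (hP n) f f).trans_lt
      (H N Q (P n) hQ hQf (hP n) (hfine N n hn))
  have hc : CauchySeq fun n => riemannSum f (P n) := by
    refine Metric.cauchySeq_iff'.2 fun ε hε => ?_
    obtain ⟨N, hN⟩ := exists_nat_one_div_lt hε
    refine ⟨N, fun n hn => ?_⟩
    rw [dist_eq_norm]
    exact (hlt N N (P n) le_rfl (hP n) (hfine N n hn)).trans hN
  obtain ⟨v, hv⟩ := cauchySeq_tendsto_of_complete hc
  refine ⟨v, fun ε hε => ?_⟩
  obtain ⟨N, hN⟩ := exists_nat_one_div_lt hε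
  refine ⟨δ N, hδ N, fun Q hQ hQf => lt_of_le_of_lt ?_ hN⟩
  refine le_of_tendsto (tendsto_const_nhds.sub hv).norm ?_
  filter_upwards [Filter.eventually_ge_atTop N] with n hn using (hlt N n Q hn hQ hQf).le

lemma HasHKIntegral.unique {a b : ℝ} (hab : a < b) {f : ℝ → X} {v w : X}
    (hv : HasHKIntegral (Icc a b) f v) (hw : HasHKIntegral (Icc a b) f w) : v = w := by
  refine eq_of_forall_dist_le fun ε hε => ?_
  obtain ⟨δ, hδ, H⟩ := hv (ε / 2) (half_pos hε)
  obtain ⟨δ', hδ', H'⟩ := hw (ε / 2) (half_pos hε)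
  obtain ⟨P, hP, hPf⟩ := exists_isHKPartition_isFine hab (hδ.min hδ')
  have h1 := H P hP hPf.of_min_left
  have h2 := H' P hP hPf.of_min_right
  rw [← dist_eq_norm] at h1 h2
  exact (dist_triangle_left _ _ _).trans (by linarith)

lemma HasHKIntegral.add_adjacent {a c b : ℝ} (hac : a < c) (hcb : c < b) {f : ℝ → X}
    {u v w : X} (hu : HasHKIntegral (Icc a c) f u) (hv : HasHKIntegral (Icc c b) f v)
    (hw : HasHKIntegral (Icc a b) f w) : w = u + v := by
  refine eq_of_forall_dist_le fun ε hε => ?_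
  obtain ⟨δ₁, hδ₁, H₁⟩ := hu (ε / 3) (by positivity)
  obtain ⟨δ₂, hδ₂, H₂⟩ := hv (ε / 3) (by positivity)
  obtain ⟨δ, hδ, H⟩ := hw (ε / 3) (by positivity)
  obtain ⟨P, hP, hPf⟩ := exists_isHKPartition_isFine hac
    (hδ₁.min fun t ht => hδ t ⟨ht.1, ht.2.trans hcb.le⟩)
  obtain ⟨Q, hQ, hQf⟩ := exists_isHKPartition_isFine hcb
    (hδ₂.min fun t ht => hδ t ⟨hac.le.trans ht.1, ht.2⟩)
  have h1 := H₁ P hP hPf.of_min_left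
  have h2 := H₂ Q hQ hQf.of_min_left
  have h3 := H _ (hP.union_Icc hac.le hcb.le hQ) fun x hx =>
    (Finset.mem_union.1 hx).elim (hPf.of_min_right x) (hQf.of_min_right x)
  have hdisj : Disjoint P Q := by
    refine Finset.disjoint_left.2 fun x hxP hxQ => ?_
    have h4 := hP.fst_lt_snd hxP
    have h5 := isSubinterval_Icc_iff.1 (hP.1.1 x hxP).2
    have h6 := isSubinterval_Icc_iff.1 (hQ.1.1 x hxQ).2
    linarith
  rw [Finset.sum_union hdisj] at h3
  set p := riemannSum f P
  set q := riemannSum f Q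
  have : w - (u + v) = (p - u) + (q - v) - (p + q - w) := by abel
  rw [dist_eq_norm, this]
  refine (norm_sub_le _ _).trans ((add_le_add_left (norm_add_le _ _) _).trans ?_)
  have h1' : ‖p - u‖ < ε / 3 := h1
  have h2' : ‖q - v‖ < ε / 3 := h2
  have h3' : ‖p + q - w‖ < ε / 3 := h3
  linarith

/-- If `[p, q]` and `[r, s]` have an interval as their union and `q ≤ r`, then `q = r`. -/
lemma Icc_union_Icc_adjacent {p q r s u w : ℝ} (hpq : p < q) (hrs : r < s) (huw : u < w)
    (hU : Icc p q ∪ Icc r s = Icc u w)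
    (h : q ≤ r) : u = p ∧ q = r ∧ s = w := by
  have hp : p ∈ Icc u w := hU ▸ Or.inl ⟨le_rfl, hpq.le⟩
  have hs : s ∈ Icc u w := hU ▸ Or.inr ⟨hrs.le, le_rfl⟩
  have hu : u ∈ Icc p q ∪ Icc r s := hU ▸ ⟨le_rfl, huw.le⟩
  have hw : w ∈ Icc p q ∪ Icc r s := hU ▸ ⟨huw.le, le_rfl⟩
  have hm : (q + r) / 2 ∈ Icc p q ∪ Icc r s := by
    rw [hU]
    exact ⟨by linarith [hp.1], by linarith [hs.2]⟩
  refine ⟨le_antisymm hp.1 ?_, le_antisymm h ?_, le_antisymm hs.2 ?_⟩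
  · rcases hu with hu | hu <;> linarith [hu.1]
  · rcases hm with hm | hm <;> linarith [hm.1, hm.2]
  · rcases hw with hw | hw <;> linarith [hw.2]

/-- A Henstock–Kurzweil integrable function with the property `𝓢*𝓗𝓚` is strongly
Henstock–Kurzweil integrable. -/
lemma PropSHK.hasStrongHKIntegral [CompleteSpace X] {a b : ℝ} (hab : a < b) {f : ℝ → X}
    (h : PropSHK a b f) {v : X} (hv : HasHKIntegral (Icc a b) f v) :
    HasStrongHKIntegral a b f v := by
  classical
  have hex : ∀ I : ℝ × ℝ, ∃ u, IsSubinterval (Icc a b) I.1 I.2 →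
      HasHKIntegral (Icc I.1 I.2) f u := by
    intro I
    by_cases hI : IsSubinterval (Icc a b) I.1 I.2
    · obtain ⟨h1, h2, h3⟩ := isSubinterval_Icc_iff.1 hI
      obtain ⟨u, hu⟩ := ((h.restrict_right h1 (h2.le.trans h3)).restrict_left h2.le
        h3).exists_hasHKIntegral h2
      exact ⟨u, fun _ => hu⟩
    · exact ⟨0, fun h => absurd h hI⟩
  choose F hF using hex
  refine ⟨F, ?_, ?_, ?_⟩
  · intro p q r s u w hpq hrs huw hd hU
    have h1 := isSubinterval_Icc_iff.1 hpq
    have h2 := isSubinterval_Icc_iff.1 hrs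
    have h3 := isSubinterval_Icc_iff.1 huw
    have hor : q ≤ r ∨ s ≤ p := by
      have := hd
      rw [interior_Icc, interior_Icc, Ioo_inter_Ioo, Ioo_eq_empty_iff, not_lt] at this
      rcases min_le_iff.1 this with h | h <;> rcases le_max_iff.1 h with h | h
      · linarith
      · exact Or.inl h
      · exact Or.inr h
      · linarith
    rcases hor with h | h
    · obtain ⟨rfl, rfl, rfl⟩ := Icc_union_Icc_adjacent h1.2.1 h2.2.1 h3.2.1 hU h
      exact (hF (_, _) hpq).add_adjacent h1.2.1 h2.2.1 (hF (_, _) hrs) (hF (_, _) huw)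
    · rw [union_comm] at hU
      obtain ⟨rfl, rfl, rfl⟩ := Icc_union_Icc_adjacent h2.2.1 h1.2.1 h3.2.1 hU h
      rw [add_comm]
      exact (hF (_, _) hrs).add_adjacent h2.2.1 h1.2.1 (hF (_, _) hpq) (hF (_, _) huw)
  · exact (hF (a, b) (isSubinterval_Icc_iff.2 ⟨le_rfl, hab, le_rfl⟩)).unique hab hv
  · intro ε hε
    obtain ⟨δ, hδ, H⟩ := h (ε / 2) (half_pos hε)
    refine ⟨δ, hδ, fun P hP hPf => ?_⟩
    set e : ℝ := ε / 2 / ((P.card : ℝ) + 1) with he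
    have he0 : 0 < e := by positivity
    have hexQ : ∀ x : ℝ × ℝ × ℝ, ∃ Q, x ∈ P → IsHKPartition (itemBox x) Q ∧ IsFine δ Q ∧
        ‖riemannSum f Q - F (x.2.1, x.2.2)‖ ≤ e := by
      intro x
      by_cases hx : x ∈ P
      · obtain ⟨δ', hδ', H'⟩ := hF (x.2.1, x.2.2) (hP.1.1 x hx).2 e he0
        obtain ⟨Q, hQ, hQf⟩ := exists_isHKPartition_isFine (hP.fst_lt_snd hx)
          (IsGauge.min hδ' fun t ht => hδ t (hP.box_subset hx ht))
        exact ⟨Q, fun _ => ⟨hQ, hQf.of_min_right, (H' Q hQ hQf.of_min_left).le⟩⟩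
      · exact ⟨∅, fun h => absurd h hx⟩
    choose R hR using hexQ
    have hR' : ∀ x ∈ P, IsHKPartition (itemBox x) (R x) := fun x hx => (hR x hx).1
    have hQf : IsFine δ (P.biUnion R) := fun z hz => by
      obtain ⟨x, hx, hz⟩ := Finset.mem_biUnion.1 hz
      exact (hR x hx).2.1 z hz
    have hle : ∀ x ∈ P, ‖(volume (itemBox x)).toReal • f x.1 - F (x.2.1, x.2.2)‖ ≤
        (∑ y ∈ P.biUnion R, ‖f x.1 - f y.1‖ * (volume (itemBox x ∩ itemBox y)).toReal) + e := by
      intro x hx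
      have h1 : ‖(volume (itemBox x)).toReal • f x.1 - riemannSum f (R x)‖ ≤
          ∑ y ∈ R x, ‖f x.1 - f y.1‖ * (volume (itemBox x ∩ itemBox y)).toReal := by
        have := norm_riemannSum_sub_le
          (isHKPartition_singleton (hP.fst_lt_snd hx) (hP.2 x hx)) (hR' x hx) f f
        simpa [riemannSum, overlapSum] using this
      have h2 : ∑ y ∈ R x, ‖f x.1 - f y.1‖ * (volume (itemBox x ∩ itemBox y)).toReal ≤
          ∑ y ∈ P.biUnion R, ‖f x.1 - f y.1‖ * (volume (itemBox x ∩ itemBox y)).toReal :=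
        Finset.sum_le_sum_of_subset_of_nonneg (Finset.subset_biUnion_of_mem R hx)
          fun _ _ _ => by positivity
      exact (norm_sub_le_norm_sub_add_norm_sub _ (riemannSum f (R x)) _).trans
        (add_le_add (h1.trans h2) (hR x hx).2.2)
    calc _ ≤ _ := Finset.sum_le_sum hle
      _ = overlapSum f f P (P.biUnion R) + P.card * e := by
        rw [Finset.sum_add_distrib, Finset.sum_const, nsmul_eq_mul]
      _ < ε / 2 + ε / 2 := by
        refine add_lt_add_of_lt_of_le (H P _ hP hPf (hP.biUnion hR') hQf) ?_
        rw [he, mul_div_left_comm]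
        exact mul_le_of_le_one_right (half_pos hε).le
          ((div_le_one (by positivity)).2 (by linarith))
      _ = ε := add_halves ε

/-- `N` is negligible for every weight: along fine HK-partitions, the weighted total length of
the intervals with tags in `N` is small. -/
def IsGaugeNull (a b : ℝ) (N : Set ℝ) : Prop :=
  ∀ w : ℝ → ℝ, (∀ t, 0 ≤ w t) → ∀ ε > 0, ∃ δ : ℝ → ℝ, IsGauge (Icc a b) δ ∧
    ∀ P : Finset (ℝ × ℝ × ℝ), IsHKPartition (Icc a b) P → IsFine δ P →
      ∑ x ∈ P, (volume (itemBox x)).toReal * N.indicator w x.1 < ε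

lemma overlapSum_le_of_norm_sub_le {a b : ℝ} {P Q : Finset (ℝ × ℝ × ℝ)}
    (hP : IsHKPartition (Icc a b) P) (hQ : IsHKPartition (Icc a b) Q) {g : ℝ → X} {d : ℝ → ℝ}
    {c : ℝ → ℝ → ℝ} (h : ∀ t ∈ Icc a b, ∀ s ∈ Icc a b, ‖g t - g s‖ ≤ c t s + (d t + d s)) :
    overlapSum g g P Q ≤
      (∑ x ∈ P, ∑ y ∈ Q, c x.1 y.1 * (volume (itemBox x ∩ itemBox y)).toReal) +
        ((∑ x ∈ P, (volume (itemBox x)).toReal * d x.1) +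
          ∑ y ∈ Q, (volume (itemBox y)).toReal * d y.1) := by
  have h1 := hP.sum_sum_left hQ (fun x => d x.1)
  have h2 := hP.sum_sum_right hQ (fun y => d y.1)
  simp only [smul_eq_mul] at h1 h2
  rw [← h1, ← h2]
  simp only [← Finset.sum_add_distrib]
  refine Finset.sum_le_sum fun x hx => Finset.sum_le_sum fun y hy => ?_
  calc _ ≤ (c x.1 y.1 + (d x.1 + d y.1)) * (volume (itemBox x ∩ itemBox y)).toReal :=
        mul_le_mul_of_nonneg_right (h _ (hP.tag_mem hx) _ (hQ.tag_mem hy)) ENNReal.toReal_nonneg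
    _ = _ := by ring

lemma PropSHK.congr_gaugeNull {a b : ℝ} {N : Set ℝ} (hN : IsGaugeNull a b N) {f g : ℝ → X}
    (hfg : ∀ t ∈ Icc a b, t ∉ N → f t = g t) (h : PropSHK a b f) : PropSHK a b g := by
  intro ε hε
  obtain ⟨δ, hδ, H⟩ := h (ε / 3) (by positivity)
  obtain ⟨δ', hδ', H'⟩ := hN (fun t => ‖f t - g t‖) (fun _ => norm_nonneg _) (ε / 3)
    (by positivity)
  refine ⟨_, hδ.min hδ', fun P Q hP hPf hQ hQf => ?_⟩
  have hd : ∀ t ∈ Icc a b, ‖f t - g t‖ ≤ N.indicator (fun t => ‖f t - g t‖) t := by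
    intro t ht
    by_cases htN : t ∈ N
    · rw [indicator_of_mem htN]
    · rw [indicator_of_notMem htN, hfg t ht htN, sub_self, norm_zero]
  have h0 := overlapSum_le_of_norm_sub_le hP hQ (g := g) (c := fun t s => ‖f t - f s‖)
    (d := N.indicator fun t => ‖f t - g t‖) fun t ht s hs => by
      refine le_trans ?_ (add_le_add_right (add_le_add (hd t ht) (hd s hs)) _)
      have : g t - g s = (f t - f s) + (-(f t - g t) + (f s - g s)) := by abel
      rw [this]
      refine (norm_add_le _ _).trans (add_le_add_right ((norm_add_le _ _).trans ?_) _)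
      rw [norm_neg]
  have h1 := H P Q hP hPf.of_min_left hQ hQf.of_min_left
  have h2 := H' P hP hPf.of_min_right
  have h3 := H' Q hQ hQf.of_min_right
  refine lt_of_le_of_lt h0 ?_
  linarith

lemma norm_riemannSum_sub_riemannSum_le (f g : ℝ → X) (P : Finset (ℝ × ℝ × ℝ)) :
    ‖riemannSum f P - riemannSum g P‖ ≤
      ∑ x ∈ P, (volume (itemBox x)).toReal * ‖f x.1 - g x.1‖ := by
  rw [riemannSum, riemannSum, ← Finset.sum_sub_distrib]
  refine (norm_sum_le _ _).trans (Finset.sum_le_sum fun x _ => ?_)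
  rw [← smul_sub, norm_smul, Real.norm_of_nonneg ENNReal.toReal_nonneg]

lemma HasHKIntegral.congr_gaugeNull {a b : ℝ} {N : Set ℝ} (hN : IsGaugeNull a b N)
    {f g : ℝ → X} (hfg : ∀ t ∈ Icc a b, t ∉ N → f t = g t) {v : X}
    (h : HasHKIntegral (Icc a b) f v) : HasHKIntegral (Icc a b) g v := by
  intro ε hε
  obtain ⟨δ, hδ, H⟩ := h (ε / 2) (by positivity)
  obtain ⟨δ', hδ', H'⟩ := hN (fun t => ‖g t - f t‖) (fun _ => norm_nonneg _) (ε / 2)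
    (by positivity)
  refine ⟨_, hδ.min hδ', fun P hP hPf => ?_⟩
  have h1 : ‖riemannSum f P - v‖ < ε / 2 := H P hP hPf.of_min_left
  have h2 := H' P hP hPf.of_min_right
  have h3 : ‖riemannSum g P - riemannSum f P‖ ≤ _ := norm_riemannSum_sub_riemannSum_le g f P
  have h4 : ∑ x ∈ P, (volume (itemBox x)).toReal * ‖g x.1 - f x.1‖ ≤
      ∑ x ∈ P, (volume (itemBox x)).toReal * N.indicator (fun t => ‖g t - f t‖) x.1 := by
    refine Finset.sum_le_sum fun x hx => mul_le_mul_of_nonneg_left ?_ ENNReal.toReal_nonneg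
    by_cases htN : x.1 ∈ N
    · rw [indicator_of_mem htN]
    · rw [indicator_of_notMem htN, hfg x.1 (hP.tag_mem hx) htN, sub_self, norm_zero]
  change ‖riemannSum g P - v‖ < ε
  refine (norm_sub_le_norm_sub_add_norm_sub _ (riemannSum f P) _).trans_lt ?_
  linarith

/-- The product of two tagged intervals. -/
def prodItem (x y : ℝ × ℝ × ℝ) : (ℝ × ℝ) × (ℝ × ℝ) × (ℝ × ℝ) :=
  ((x.1, y.1), (x.2.1, y.2.1), (x.2.2, y.2.2))

lemma itemBox_prodItem (x y : ℝ × ℝ × ℝ) : itemBox (prodItem x y) = itemBox x ×ˢ itemBox y :=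
  (Icc_prod_Icc _ _ _ _).symm

/-- The planar collection with rows over the intervals of `R`, the row tagged by `t` being cut
along `P t`. -/
def rowPartition (R : Finset (ℝ × ℝ × ℝ)) (P : ℝ → Finset (ℝ × ℝ × ℝ)) :
    Finset ((ℝ × ℝ) × (ℝ × ℝ) × (ℝ × ℝ)) :=
  (R.sigma fun y => P y.1).map ⟨fun z => prodItem z.2 z.1, by
    rintro ⟨⟨y₁, y₂, y₃⟩, ⟨x₁, x₂, x₃⟩⟩ ⟨⟨y₁', y₂', y₃'⟩, ⟨x₁', x₂', x₃'⟩⟩ h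
    simp only [prodItem, Prod.mk.injEq] at h
    obtain ⟨⟨rfl, rfl⟩, ⟨rfl, rfl⟩, rfl, rfl⟩ := h
    rfl⟩

lemma mem_rowPartition {R : Finset (ℝ × ℝ × ℝ)} {P : ℝ → Finset (ℝ × ℝ × ℝ)}
    {z : (ℝ × ℝ) × (ℝ × ℝ) × (ℝ × ℝ)} :
    z ∈ rowPartition R P ↔ ∃ y ∈ R, ∃ x ∈ P y.1, prodItem x y = z := by
  simp only [rowPartition, Finset.mem_map, Finset.mem_sigma,
    Sigma.exists]
  exact ⟨fun ⟨y, x, ⟨hy, hx⟩, h⟩ => ⟨y, hy, x, hx, h⟩, fun ⟨y, hy, x, hx, h⟩ =>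
    ⟨y, x, ⟨hy, hx⟩, h⟩⟩

lemma sum_rowPartition {M : Type*} [AddCommMonoid M] (R : Finset (ℝ × ℝ × ℝ))
    (P : ℝ → Finset (ℝ × ℝ × ℝ)) (u : (ℝ × ℝ) × (ℝ × ℝ) × (ℝ × ℝ) → M) :
    ∑ z ∈ rowPartition R P, u z = ∑ y ∈ R, ∑ x ∈ P y.1, u (prodItem x y) := by
  rw [rowPartition, Finset.sum_map, Finset.sum_sigma]
  rfl

lemma isHKPartition_rowPartition {a₁ b₁ a₂ b₂ : ℝ} {R : Finset (ℝ × ℝ × ℝ)}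
    {P : ℝ → Finset (ℝ × ℝ × ℝ)} (hR : IsHKPartition (Icc a₂ b₂) R)
    (hP : ∀ t ∈ Icc a₂ b₂, IsHKPartition (Icc a₁ b₁) (P t)) :
    IsHKPartition (Icc ((a₁, a₂) : ℝ × ℝ) (b₁, b₂)) (rowPartition R P) := by
  have hP' : ∀ y ∈ R, IsHKPartition (Icc a₁ b₁) (P y.1) := fun y hy => hP _ (hR.tag_mem hy)
  rw [← Icc_prod_Icc]
  refine ⟨⟨fun z hz => ?_, fun z hz z' hz' hne => ?_, ?_⟩, fun z hz => ?_⟩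
  · obtain ⟨y, hy, x, hx, rfl⟩ := mem_rowPartition.1 hz
    refine ⟨⟨(hP' y hy).tag_mem hx, hR.tag_mem hy⟩, ?_, ?_⟩
    · change itemBox (prodItem x y) ⊆ _
      rw [itemBox_prodItem]
      exact prod_mono ((hP' y hy).box_subset hx) (hR.box_subset hy)
    · change (interior (itemBox (prodItem x y))).Nonempty
      rw [itemBox_prodItem, interior_prod_eq]
      exact (((hP' y hy).1.1 x hx).2.2).prod (hR.1.1 y hy).2.2
  · obtain ⟨y, hy, x, hx, rfl⟩ := mem_rowPartition.1 hz
    obtain ⟨y', hy', x', hx', rfl⟩ := mem_rowPartition.1 hz'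
    rw [itemBox_prodItem, itemBox_prodItem, interior_prod_eq, interior_prod_eq, prod_inter_prod]
    by_cases hyy : y = y'
    · subst hyy
      have hxx : x ≠ x' := fun h => hne (by rw [h])
      rw [(hP' y hy).1.2.1 x hx x' hx' hxx, empty_prod]
    · rw [hR.1.2.1 y hy y' hy' hyy, prod_empty]
  · ext ⟨u, w⟩
    simp only [mem_iUnion, exists_prop, mem_rowPartition]
    constructor
    · rintro ⟨_, ⟨y, hy, x, hx, rfl⟩, h⟩
      rw [itemBox_prodItem] at h
      exact ⟨(hP' y hy).box_subset hx h.1, hR.box_subset hy h.2⟩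
    · rintro ⟨hu, hw⟩
      rw [← hR.1.2.2] at hw
      obtain ⟨y, hy, hwy⟩ := mem_iUnion₂.1 hw
      change u ∈ Icc a₁ b₁ at hu
      rw [← (hP' y hy).1.2.2] at hu
      obtain ⟨x, hx, hux⟩ := mem_iUnion₂.1 hu
      exact ⟨_, ⟨y, hy, x, hx, rfl⟩, by rw [itemBox_prodItem]; exact ⟨hux, hwy⟩⟩
  · obtain ⟨y, hy, x, hx, rfl⟩ := mem_rowPartition.1 hz
    rw [itemBox_prodItem]
    exact ⟨(hP' y hy).2 x hx, hR.2 y hy⟩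

/-- A gauge on the vertical side that makes row partitions fine. -/
lemma exists_gauge_rowPartition {a₁ b₁ a₂ b₂ : ℝ} {δ : ℝ × ℝ → ℝ}
    (hδ : IsGauge (Icc ((a₁, a₂) : ℝ × ℝ) (b₁, b₂)) δ) {P : ℝ → Finset (ℝ × ℝ × ℝ)}
    (hP : ∀ t ∈ Icc a₂ b₂, IsHKPartition (Icc a₁ b₁) (P t))
    (hPf : ∀ t ∈ Icc a₂ b₂, IsFine (fun s => δ (s, t)) (P t)) :
    ∃ η, IsGauge (Icc a₂ b₂) η ∧ ∀ R, IsHKPartition (Icc a₂ b₂) R → IsFine η R →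
      IsFine δ (rowPartition R P) := by
  have hex : ∀ t, ∃ r, t ∈ Icc a₂ b₂ → 0 < r ∧ ∀ x ∈ P t, r ≤ δ (x.1, t) := by
    intro t
    by_cases ht : t ∈ Icc a₂ b₂
    · rcases (P t).eq_empty_or_nonempty with h | h
      · exact ⟨1, fun _ => ⟨one_pos, by simp [h]⟩⟩
      · refine ⟨(P t).inf' h fun x => δ (x.1, t), fun _ => ⟨(Finset.lt_inf'_iff _).2 ?_,
          fun x hx => Finset.inf'_le (fun x => δ (x.1, t)) hx⟩⟩
        exact fun x hx => hδ _ ⟨⟨((hP t ht).tag_mem hx).1, ht.1⟩, ((hP t ht).tag_mem hx).2, ht.2⟩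
    · exact ⟨0, fun h => absurd h ht⟩
  choose η hη using hex
  refine ⟨η, fun t ht => (hη t ht).1, fun R hR hRf z hz => ?_⟩
  obtain ⟨y, hy, x, hx, rfl⟩ := mem_rowPartition.1 hz
  rw [itemBox_prodItem]
  change _ ⊆ Metric.ball (x.1, y.1) (δ (x.1, y.1))
  rw [← ball_prod_same]
  exact prod_mono (hPf y.1 (hR.tag_mem hy) x hx)
    ((hRf y hy).trans (Metric.ball_subset_ball ((hη y.1 (hR.tag_mem hy)).2 x hx)))

lemma riemannSum_rowPartition (f : ℝ × ℝ → X) (R : Finset (ℝ × ℝ × ℝ))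
    (P : ℝ → Finset (ℝ × ℝ × ℝ)) :
    riemannSum f (rowPartition R P) =
      riemannSum (fun t => riemannSum (fun s => f (s, t)) (P t)) R := by
  rw [riemannSum, sum_rowPartition]
  refine Finset.sum_congr rfl fun y _ => ?_
  rw [Finset.smul_sum]
  refine Finset.sum_congr rfl fun x _ => ?_
  rw [itemBox_prodItem, Measure.volume_eq_prod, Measure.prod_prod, ENNReal.toReal_mul, mul_comm,
    mul_smul]
  rfl

lemma overlapSum_rowPartition (f : ℝ × ℝ → X) (R R' : Finset (ℝ × ℝ × ℝ))
    (P Q : ℝ → Finset (ℝ × ℝ × ℝ)) :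
    overlapSum f f (rowPartition R P) (rowPartition R' Q) =
      ∑ y ∈ R, ∑ y' ∈ R', overlapSum (fun s => f (s, y.1)) (fun s => f (s, y'.1))
        (P y.1) (Q y'.1) * (volume (itemBox y ∩ itemBox y')).toReal := by
  rw [overlapSum, sum_rowPartition]
  refine Finset.sum_congr rfl fun y _ => ?_
  simp only [sum_rowPartition]
  rw [Finset.sum_comm]
  refine Finset.sum_congr rfl fun y' _ => ?_
  rw [overlapSum, Finset.sum_mul]
  refine Finset.sum_congr rfl fun x _ => ?_
  rw [Finset.sum_mul]
  refine Finset.sum_congr rfl fun x' _ => ?_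
  rw [itemBox_prodItem, itemBox_prodItem, prod_inter_prod, Measure.volume_eq_prod,
    Measure.prod_prod, ENNReal.toReal_mul, mul_assoc]
  rfl

/-- Outside a set whose tags carry little length, the sections of a function with the property
`𝓢*𝓗𝓚` have small overlap sums. -/
lemma PropSHK.exists_exceptional_set {a₁ b₁ a₂ b₂ : ℝ} (hab₁ : a₁ < b₁) {f : ℝ × ℝ → X}
    (h : PropSHK ((a₁, a₂) : ℝ × ℝ) (b₁, b₂) f) {r ε : ℝ} (hε : 0 < ε) :
    ∃ (A : Set ℝ) (η : ℝ → ℝ), IsGauge (Icc a₂ b₂) η ∧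
      (∀ t ∈ Icc a₂ b₂, t ∉ A → ∃ δ, IsGauge (Icc a₁ b₁) δ ∧ ∀ P Q,
        IsHKPartition (Icc a₁ b₁) P → IsFine δ P → IsHKPartition (Icc a₁ b₁) Q → IsFine δ Q →
        overlapSum (fun s => f (s, t)) (fun s => f (s, t)) P Q < r) ∧
      ∀ R, IsHKPartition (Icc a₂ b₂) R → IsFine η R →
        ∑ y ∈ R, (volume (itemBox y)).toReal * A.indicator (fun _ => r) y.1 < ε := by
  obtain ⟨δ, hδ, H⟩ := h ε hε
  have hδ' : ∀ t ∈ Icc a₂ b₂, IsGauge (Icc a₁ b₁) fun s => δ (s, t) :=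
    fun t ht s hs => hδ _ ⟨⟨hs.1, ht.1⟩, hs.2, ht.2⟩
  set A : Set ℝ := {t | ∃ P Q, IsHKPartition (Icc a₁ b₁) P ∧ IsFine (fun s => δ (s, t)) P ∧
    IsHKPartition (Icc a₁ b₁) Q ∧ IsFine (fun s => δ (s, t)) Q ∧
    r ≤ overlapSum (fun s => f (s, t)) (fun s => f (s, t)) P Q} with hA
  have hex : ∀ t, ∃ P Q, t ∈ Icc a₂ b₂ →
      IsHKPartition (Icc a₁ b₁) P ∧ IsFine (fun s => δ (s, t)) P ∧
      IsHKPartition (Icc a₁ b₁) Q ∧ IsFine (fun s => δ (s, t)) Q ∧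
      A.indicator (fun _ => r) t ≤ overlapSum (fun s => f (s, t)) (fun s => f (s, t)) P Q := by
    intro t
    by_cases ht : t ∈ Icc a₂ b₂
    · by_cases htA : t ∈ A
      · have htA' := htA
        obtain ⟨P, Q, hP⟩ := htA
        exact ⟨P, Q, fun _ => by rwa [indicator_of_mem htA']⟩
      · obtain ⟨P, hP, hPf⟩ := exists_isHKPartition_isFine hab₁ (hδ' t ht)
        refine ⟨P, P, fun _ => ⟨hP, hPf, hP, hPf, ?_⟩⟩
        rw [indicator_of_notMem htA]
        exact overlapSum_nonneg _ _ _ _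
    · exact ⟨∅, ∅, fun h => absurd h ht⟩
  choose P Q hPQ using hex
  obtain ⟨η, hη, Hη⟩ := exists_gauge_rowPartition hδ (fun t ht => (hPQ t ht).1)
    fun t ht => (hPQ t ht).2.1
  obtain ⟨η', hη', Hη'⟩ := exists_gauge_rowPartition hδ (fun t ht => (hPQ t ht).2.2.1)
    fun t ht => (hPQ t ht).2.2.2.1
  refine ⟨A, _, hη.min hη', fun t ht htA => ⟨_, hδ' t ht, fun P Q hP hPf hQ hQf => ?_⟩,
    fun R hR hRf => ?_⟩
  · by_contra hcon
    exact htA ⟨P, Q, hP, hPf, hQ, hQf, not_lt.1 hcon⟩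
  · have h1 := H _ _ (isHKPartition_rowPartition hR fun t ht => (hPQ t ht).1)
      (Hη R hR hRf.of_min_left)
      (isHKPartition_rowPartition hR fun t ht => (hPQ t ht).2.2.1) (Hη' R hR hRf.of_min_right)
    change overlapSum f f _ _ < ε at h1
    rw [overlapSum_rowPartition] at h1
    refine lt_of_le_of_lt (Finset.sum_le_sum fun y hy => ?_) h1
    refine le_trans ?_ (Finset.single_le_sum (fun y' _ =>
      mul_nonneg (overlapSum_nonneg _ _ _ _) ENNReal.toReal_nonneg) hy)
    rw [inter_self, mul_comm]
    exact mul_le_mul_of_nonneg_right (hPQ _ (hR.tag_mem hy)).2.2.2.2 ENNReal.toReal_nonneg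

/-- The parameters whose section fails the property `𝓢*𝓗𝓚` form a negligible set. -/
lemma PropSHK.isGaugeNull_snd {a₁ b₁ a₂ b₂ : ℝ} (hab₁ : a₁ < b₁) {f : ℝ × ℝ → X}
    (h : PropSHK ((a₁, a₂) : ℝ × ℝ) (b₁, b₂) f) :
    IsGaugeNull a₂ b₂ {t | t ∈ Icc a₂ b₂ ∧ ¬ PropSHK a₁ b₁ fun s => f (s, t)} := by
  classical
  intro w hw ε hε
  set Z : Set ℝ := {t | t ∈ Icc a₂ b₂ ∧ ¬ PropSHK a₁ b₁ fun s => f (s, t)} with hZ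
  choose A η hη hA H using fun n : ℕ =>
    h.exists_exceptional_set hab₁ (r := (1 / 2) ^ n) (ε := (1 / 8) ^ n) (by positivity)
  have hex : ∀ t, ∃ n, t ∈ Z → t ∈ A n ∧ w t ≤ ε / 4 * 2 ^ n := by
    intro t
    by_cases ht : t ∈ Z
    · have hfail := ht.2
      unfold PropSHK at hfail
      push Not at hfail
      obtain ⟨e, he, hfail⟩ := hfail
      have h1 := (tendsto_pow_atTop_nhds_zero_of_lt_one (r := (1 / 2 : ℝ)) (by norm_num)
        (by norm_num)).eventually_lt_const he
      have h2 := (tendsto_pow_atTop_atTop_of_one_lt (r := (2 : ℝ)) (by norm_num)).eventually_ge_atTop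
        (w t / (ε / 4))
      obtain ⟨n, hn1, hn2⟩ := (h1.and h2).exists
      refine ⟨n, fun _ => ⟨?_, ?_⟩⟩
      · by_contra hnA
        obtain ⟨δ, hδ, Hδ⟩ := hA n t ht.1 hnA
        obtain ⟨P, Q, hP, hPf, hQ, hQf, hPQ⟩ := hfail δ hδ
        exact absurd (Hδ P Q hP hPf hQ hQf) (not_lt.2 (hn1.le.trans hPQ))
      · rwa [div_le_iff₀' (by positivity)] at hn2
    · exact ⟨0, fun h => absurd h ht⟩
  choose n hn using hex
  refine ⟨fun t => η (n t) t, fun t ht => hη _ t ht, fun P hP hPf => ?_⟩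
  have hfiber : ∀ k, ∑ x ∈ P with n x.1 = k, (volume (itemBox x)).toReal * Z.indicator w x.1 ≤
      ε / 4 * (1 / 2) ^ k := by
    intro k
    obtain ⟨Q, hQ, hQf, hPQ⟩ := hP.exists_isFine_refinement (hη k)
    have hsub : P.filter (fun x => n x.1 = k) ⊆ Q := fun x hx => by
      obtain ⟨hx, hk⟩ := Finset.mem_filter.1 hx
      exact hPQ x hx (hk ▸ hPf x hx)
    have hnn : ∀ x : ℝ × ℝ × ℝ, 0 ≤ ε / 4 * 4 ^ k *
        ((volume (itemBox x)).toReal * (A k).indicator (fun _ => (1 / 2) ^ k) x.1) :=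
      fun x => mul_nonneg (by positivity) (mul_nonneg ENNReal.toReal_nonneg
        (indicator_nonneg (fun _ _ => by positivity) _))
    calc _ ≤ ∑ x ∈ P with n x.1 = k, ε / 4 * 4 ^ k *
          ((volume (itemBox x)).toReal * (A k).indicator (fun _ => (1 / 2) ^ k) x.1) := by
          refine Finset.sum_le_sum fun x hx => ?_
          by_cases hxZ : x.1 ∈ Z
          · obtain ⟨h1, h2⟩ := hn x.1 hxZ
            rw [(Finset.mem_filter.1 hx).2] at h1 h2
            rw [indicator_of_mem hxZ, indicator_of_mem h1, mul_left_comm]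
            refine mul_le_mul_of_nonneg_left (h2.trans_eq ?_) ENNReal.toReal_nonneg
            rw [mul_assoc, ← mul_pow]
            norm_num
          · rw [indicator_of_notMem hxZ, mul_zero]
            exact hnn x
      _ ≤ ∑ x ∈ Q, ε / 4 * 4 ^ k *
          ((volume (itemBox x)).toReal * (A k).indicator (fun _ => (1 / 2) ^ k) x.1) :=
          Finset.sum_le_sum_of_subset_of_nonneg hsub fun x _ _ => hnn x
      _ ≤ ε / 4 * 4 ^ k * (1 / 8) ^ k := by
          rw [← Finset.mul_sum]
          exact mul_le_mul_of_nonneg_left (H k Q hQ hQf).le (by positivity)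
      _ = ε / 4 * (1 / 2) ^ k := by
          rw [mul_assoc, ← mul_pow]
          norm_num
  rw [← Finset.sum_fiberwise_of_maps_to (t := P.image fun x => n x.1) (g := fun x => n x.1)
    fun x hx => Finset.mem_image_of_mem _ hx]
  calc _ ≤ ∑ k ∈ P.image fun x => n x.1, ε / 4 * (1 / 2) ^ k :=
        Finset.sum_le_sum fun k _ => hfiber k
    _ = ε / 4 * ∑ k ∈ P.image fun x => n x.1, (1 / 2) ^ k := by rw [Finset.mul_sum]
    _ ≤ ε / 4 * 2 := by
        refine mul_le_mul_of_nonneg_left ?_ (by positivity)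
        exact (summable_geometric_two.sum_le_tsum _ fun _ _ => by positivity).trans_eq
          tsum_geometric_two
    _ < ε := by linarith

/-- Exchange of the coordinates in a tagged planar interval. -/
def swapItem : (ℝ × ℝ) × (ℝ × ℝ) × (ℝ × ℝ) ≃ (ℝ × ℝ) × (ℝ × ℝ) × (ℝ × ℝ) :=
  (Equiv.prodComm ℝ ℝ).prodCongr ((Equiv.prodComm ℝ ℝ).prodCongr (Equiv.prodComm ℝ ℝ))

lemma Icc_swap (p q : ℝ × ℝ) : Icc p.swap q.swap = Homeomorph.prodComm ℝ ℝ ⁻¹' Icc p q := by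
  ext ⟨u, v⟩
  simp [Prod.le_def, and_comm]

lemma itemBox_swapItem (z : (ℝ × ℝ) × (ℝ × ℝ) × (ℝ × ℝ)) :
    itemBox (swapItem z) = Homeomorph.prodComm ℝ ℝ ⁻¹' itemBox z := Icc_swap z.2.1 z.2.2

lemma IsHKPartition.map_swapItem {p q : ℝ × ℝ} {P : Finset ((ℝ × ℝ) × (ℝ × ℝ) × (ℝ × ℝ))}
    (h : IsHKPartition (Icc p q) P) :
    IsHKPartition (Icc p.swap q.swap) (P.map swapItem.toEmbedding) := by
  rw [Icc_swap]
  refine ⟨⟨?_, ?_, ?_⟩, ?_⟩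
  · refine Finset.forall_mem_map.2 fun z hz => ⟨h.tag_mem hz, ?_, ?_⟩
    · change itemBox (swapItem z) ⊆ _
      rw [itemBox_swapItem]
      exact preimage_mono (h.box_subset hz)
    · change (interior (itemBox (swapItem z))).Nonempty
      rw [itemBox_swapItem, ← Homeomorph.preimage_interior]
      exact (h.1.1 z hz).2.2.preimage (Homeomorph.surjective _)
  · refine Finset.forall_mem_map.2 fun z hz => Finset.forall_mem_map.2 fun z' hz' hne => ?_
    rw [Equiv.coe_toEmbedding, itemBox_swapItem, itemBox_swapItem, ← Homeomorph.preimage_interior,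
      ← Homeomorph.preimage_interior, ← preimage_inter,
      h.1.2.1 z hz z' hz' fun h => hne (by rw [h]), preimage_empty]
  · classical
    rw [Finset.map_eq_image, Finset.set_biUnion_finset_image, ← h.1.2.2, preimage_iUnion₂]
    exact iUnion₂_congr fun z _ => itemBox_swapItem z
  · refine Finset.forall_mem_map.2 fun z hz => ?_
    rw [Equiv.coe_toEmbedding, itemBox_swapItem]
    exact h.2 z hz

lemma IsFine.map_swapItem {δ : ℝ × ℝ → ℝ} {P : Finset ((ℝ × ℝ) × (ℝ × ℝ) × (ℝ × ℝ))}
    (h : IsFine (fun t => δ t.swap) P) : IsFine δ (P.map swapItem.toEmbedding) := by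
  refine Finset.forall_mem_map.2 fun z hz => ?_
  change itemBox (swapItem z) ⊆ _
  rw [itemBox_swapItem]
  intro u hu
  have := h z hz hu
  rw [Metric.mem_ball, Prod.dist_eq, max_comm] at this
  exact this

lemma PropSHK.swap {p q : ℝ × ℝ} {f : ℝ × ℝ → X} (h : PropSHK p q f) :
    PropSHK p.swap q.swap fun t => f t.swap := by
  intro ε hε
  obtain ⟨δ, hδ, H⟩ := h ε hε
  refine ⟨fun t => δ t.swap, fun t ht => hδ _ ?_, fun P Q hP hPf hQ hQf => ?_⟩
  · rwa [Icc_swap] at ht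
  · have h1 := H _ _ hP.map_swapItem hPf.map_swapItem hQ.map_swapItem hQf.map_swapItem
    rw [Finset.sum_map] at h1
    refine lt_of_eq_of_lt (Finset.sum_congr rfl fun x _ => ?_) h1
    rw [Finset.sum_map]
    refine Finset.sum_congr rfl fun y _ => ?_
    simp only [Equiv.coe_toEmbedding, itemBox_swapItem]
    rw [← preimage_inter]
    have h2 : volume (Homeomorph.prodComm ℝ ℝ ⁻¹' (itemBox x ∩ itemBox y)) =
        volume (itemBox x ∩ itemBox y) :=
      (Measure.measurePreserving_swap (μ := (volume : Measure ℝ))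
        (ν := (volume : Measure ℝ))).measure_preimage
        (measurableSet_Icc.inter measurableSet_Icc).nullMeasurableSet
    rw [h2]
    rfl

lemma PropSHK.isGaugeNull_fst {a₁ b₁ a₂ b₂ : ℝ} (hab₂ : a₂ < b₂) {f : ℝ × ℝ → X}
    (h : PropSHK ((a₁, a₂) : ℝ × ℝ) (b₁, b₂) f) :
    IsGaugeNull a₁ b₁ {t | t ∈ Icc a₁ b₁ ∧ ¬ PropSHK a₂ b₂ fun s => f (t, s)} :=
  h.swap.isGaugeNull_snd hab₂

/-- Fubini's theorem for row integrals that exist off a negligible set of parameters. -/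
lemma PropSHK.fubini_snd [CompleteSpace X] {a₁ b₁ a₂ b₂ : ℝ} (hab₁ : a₁ < b₁) (hab₂ : a₂ < b₂)
    {f : ℝ × ℝ → X} {v : X} (hfS : PropSHK ((a₁, a₂) : ℝ × ℝ) (b₁, b₂) f)
    (hf : HasHKIntegral (Icc ((a₁, a₂) : ℝ × ℝ) (b₁, b₂)) f v) {N : Set ℝ}
    (hN : IsGaugeNull a₂ b₂ N) {h : ℝ → X}
    (hh : ∀ t ∈ Icc a₂ b₂, t ∉ N → HasHKIntegral (Icc a₁ b₁) (fun s => f (s, t)) (h t)) :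
    HasStrongHKIntegral a₂ b₂ h v := by
  have key : ∀ ε > 0, ∀ δ, IsGauge (Icc ((a₁, a₂) : ℝ × ℝ) (b₁, b₂)) δ →
      ∃ (P : ℝ → Finset (ℝ × ℝ × ℝ)) (η : ℝ → ℝ),
        (∀ t ∈ Icc a₂ b₂, IsHKPartition (Icc a₁ b₁) (P t)) ∧ IsGauge (Icc a₂ b₂) η ∧
        ∀ R, IsHKPartition (Icc a₂ b₂) R → IsFine η R → IsFine δ (rowPartition R P) ∧
          ∑ y ∈ R, (volume (itemBox y)).toReal *
            ‖h y.1 - riemannSum (fun s => f (s, y.1)) (P y.1)‖ < ε := by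
    intro ε hε δ hδ
    have hc : 0 < b₂ - a₂ := sub_pos.2 hab₂
    set e : ℝ := ε / 2 / (b₂ - a₂) with he
    have he0 : 0 < e := by positivity
    have hex : ∀ t, ∃ P, t ∈ Icc a₂ b₂ → IsHKPartition (Icc a₁ b₁) P ∧
        IsFine (fun s => δ (s, t)) P ∧
        (t ∉ N → ‖h t - riemannSum (fun s => f (s, t)) P‖ ≤ e) := by
      intro t
      by_cases ht : t ∈ Icc a₂ b₂
      · have hδ' : IsGauge (Icc a₁ b₁) fun s => δ (s, t) :=
          fun s hs => hδ _ ⟨⟨hs.1, ht.1⟩, hs.2, ht.2⟩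
        by_cases htN : t ∈ N
        · obtain ⟨P, hP, hPf⟩ := exists_isHKPartition_isFine hab₁ hδ'
          exact ⟨P, fun _ => ⟨hP, hPf, fun h => absurd htN h⟩⟩
        · obtain ⟨δ₁, hδ₁, H₁⟩ := hh t ht htN e he0
          obtain ⟨P, hP, hPf⟩ := exists_isHKPartition_isFine hab₁ (hδ'.min hδ₁)
          refine ⟨P, fun _ => ⟨hP, hPf.of_min_left, fun _ => ?_⟩⟩
          rw [norm_sub_rev]
          exact (H₁ P hP hPf.of_min_right).le
      · exact ⟨∅, fun h => absurd h ht⟩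
    choose P hP using hex
    obtain ⟨η, hη, Hη⟩ := exists_gauge_rowPartition hδ (fun t ht => (hP t ht).1)
      fun t ht => (hP t ht).2.1
    obtain ⟨η', hη', Hη'⟩ := hN (fun t => ‖h t - riemannSum (fun s => f (s, t)) (P t)‖)
      (fun _ => norm_nonneg _) (ε / 2) (half_pos hε)
    refine ⟨P, _, fun t ht => (hP t ht).1, hη.min hη', fun R hR hRf =>
      ⟨Hη R hR hRf.of_min_left, ?_⟩⟩
    have h1 := Hη' R hR hRf.of_min_right
    have h2 : ∑ y ∈ R, (volume (itemBox y)).toReal * e = ε / 2 := by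
      rw [← Finset.sum_mul, hR.sum_volume hab₂.le, he, mul_div_cancel₀ _ hc.ne']
    have h3 : ∑ y ∈ R, (volume (itemBox y)).toReal *
        ‖h y.1 - riemannSum (fun s => f (s, y.1)) (P y.1)‖ ≤
        ∑ y ∈ R, ((volume (itemBox y)).toReal * e + (volume (itemBox y)).toReal *
          N.indicator (fun t => ‖h t - riemannSum (fun s => f (s, t)) (P t)‖) y.1) := by
      refine Finset.sum_le_sum fun y hy => ?_
      rw [← mul_add]
      refine mul_le_mul_of_nonneg_left ?_ ENNReal.toReal_nonneg
      by_cases hyN : y.1 ∈ N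
      · rw [indicator_of_mem hyN]
        linarith
      · rw [indicator_of_notMem hyN, add_zero]
        exact (hP _ (hR.tag_mem hy)).2.2 hyN
    rw [Finset.sum_add_distrib] at h3
    linarith
  have hS : PropSHK a₂ b₂ h := by
    intro ε hε
    obtain ⟨δ, hδ, H⟩ := hfS (ε / 3) (by positivity)
    obtain ⟨P, η, hP, hη, Hη⟩ := key (ε / 3) (by positivity) δ hδ
    refine ⟨η, hη, fun R R' hR hRf hR' hRf' => ?_⟩
    obtain ⟨h1, h2⟩ := Hη R hR hRf
    obtain ⟨h1', h2'⟩ := Hη R' hR' hRf'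
    have h3 := H _ _ (isHKPartition_rowPartition hR hP) h1 (isHKPartition_rowPartition hR' hP) h1'
    change overlapSum f f _ _ < _ at h3
    rw [overlapSum_rowPartition] at h3
    have h4 := overlapSum_le_of_norm_sub_le hR hR' (g := h)
      (c := fun t s => overlapSum (fun u => f (u, t)) (fun u => f (u, s)) (P t) (P s))
      (d := fun t => ‖h t - riemannSum (fun s => f (s, t)) (P t)‖) fun t ht s hs => by
        have h5 := norm_riemannSum_sub_le (hP t ht) (hP s hs) (fun u => f (u, t))
          fun u => f (u, s)
        set p := riemannSum (fun u => f (u, t)) (P t)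
        set q := riemannSum (fun u => f (u, s)) (P s)
        have h6 : h t - h s = (p - q) + ((h t - p) - (h s - q)) := by abel
        rw [h6]
        exact (norm_add_le _ _).trans (add_le_add h5 (norm_sub_le _ _))
    change overlapSum h h R R' < ε
    linarith
  refine hS.hasStrongHKIntegral hab₂ fun ε hε => ?_
  obtain ⟨δ, hδ, H⟩ := hf (ε / 2) (half_pos hε)
  obtain ⟨P, η, hP, hη, Hη⟩ := key (ε / 2) (half_pos hε) δ hδ
  refine ⟨η, hη, fun R hR hRf => ?_⟩
  obtain ⟨h1, h2⟩ := Hη R hR hRf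
  have h3 : ‖riemannSum f (rowPartition R P) - v‖ < ε / 2 :=
    H _ (isHKPartition_rowPartition hR hP) h1
  rw [riemannSum_rowPartition] at h3
  have h4 := norm_riemannSum_sub_riemannSum_le h
    (fun t => riemannSum (fun s => f (s, t)) (P t)) R
  exact (norm_sub_le_norm_sub_add_norm_sub _ _ _).trans_lt (by linarith)

lemma propSHK_zero (a b : ℝ) : PropSHK a b fun _ => (0 : X) := fun ε hε =>
  ⟨fun _ => 1, fun _ _ => one_pos, fun P Q _ _ _ _ => by simpa using hε⟩

/-- Theorem 2.2(iii): `h(t₂) = ∫_{[a₁,b₁]} (f₀)_{t₂}` is strongly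
integrable on `[a₂,b₂]` and its integral equals `∫_{[a,b]} f = v`. -/
theorem fubini_main_hk_snd {X : Type*} [NormedAddCommGroup X] [NormedSpace ℝ X] [CompleteSpace X] (a₁ b₁ a₂ b₂ : ℝ) (hab₁ : a₁ < b₁) (hab₂ : a₂ < b₂)
    (f : ℝ × ℝ → X) (v : X)
    (hfS : PropSHK ((a₁, a₂) : ℝ × ℝ) (b₁, b₂) f)
    (hf : HasHKIntegral (Set.Icc ((a₁, a₂) : ℝ × ℝ) (b₁, b₂)) f v)
    (Z₁ : Set ℝ) (hZ₁ : Z₁ = {t₁ : ℝ | t₁ ∈ Set.Icc a₁ b₁ ∧ ¬ PropSHK a₂ b₂ (fun s₂ => f (t₁, s₂))})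
    (Z₂ : Set ℝ) (hZ₂ : Z₂ = {t₂ : ℝ | t₂ ∈ Set.Icc a₂ b₂ ∧ ¬ PropSHK a₁ b₁ (fun s₁ => f (s₁, t₂))})
    (Z : Set (ℝ × ℝ)) (hZ : Z = (Z₁ ×ˢ Set.Icc a₂ b₂) ∪ ((Set.Icc a₁ b₁) ×ˢ Z₂))
    (f₀ : ℝ × ℝ → X) (hf₀ : f₀ = ((Set.Icc ((a₁, a₂) : ℝ × ℝ) (b₁, b₂)) \ Z).indicator f) :
    ∃ h : ℝ → X,
      (∀ t₂ ∈ Set.Icc a₂ b₂, HasStrongHKIntegral a₁ b₁ (fun s₁ => f₀ (s₁, t₂)) (h t₂)) ∧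
      HasStrongHKIntegral a₂ b₂ h v := by
  have hN₁ : IsGaugeNull a₁ b₁ Z₁ := hZ₁ ▸ hfS.isGaugeNull_fst hab₂
  have hN₂ : IsGaugeNull a₂ b₂ Z₂ := hZ₂ ▸ hfS.isGaugeNull_snd hab₁
  have hgood : ∀ t ∈ Icc a₂ b₂, t ∉ Z₂ → ∀ s ∈ Icc a₁ b₁, s ∉ Z₁ → f (s, t) = f₀ (s, t) := by
    intro t ht htZ s hs hsZ
    rw [hf₀, indicator_of_mem]
    refine ⟨⟨⟨hs.1, ht.1⟩, hs.2, ht.2⟩, ?_⟩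
    rw [hZ]
    rintro (h | h)
    · exact hsZ h.1
    · exact htZ h.2
  have hS : ∀ t ∈ Icc a₂ b₂, PropSHK a₁ b₁ fun s => f₀ (s, t) := by
    intro t ht
    by_cases htZ : t ∈ Z₂
    · have h0 : (fun s => f₀ (s, t)) = fun _ => 0 := by
        funext s
        rw [hf₀, indicator_of_notMem]
        rintro ⟨h1, h2⟩
        rw [hZ] at h2
        exact h2 (Or.inr ⟨⟨h1.1.1, h1.2.1⟩, htZ⟩)
      rw [h0]
      exact propSHK_zero a₁ b₁
    · refine PropSHK.congr_gaugeNull hN₁ (hgood t ht htZ) ?_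
      by_contra hcon
      exact htZ (hZ₂ ▸ ⟨ht, hcon⟩)
  have hex : ∀ t, ∃ u, t ∈ Icc a₂ b₂ → HasHKIntegral (Icc a₁ b₁) (fun s => f₀ (s, t)) u := by
    intro t
    by_cases ht : t ∈ Icc a₂ b₂
    · obtain ⟨u, hu⟩ := (hS t ht).exists_hasHKIntegral hab₁
      exact ⟨u, fun _ => hu⟩
    · exact ⟨0, fun h => absurd h ht⟩
  choose h hh using hex
  exact ⟨h, fun t ht => (hS t ht).hasStrongHKIntegral hab₁ (hh t ht),
    hfS.fubini_snd hab₁ hab₂ hf hN₂ fun t ht htZ => (hh t ht).congr_gaugeNull hN₁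
      fun s hs hsZ => (hgood t ht htZ s hs hsZ).symm⟩
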